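/- Let P be a two-color grid poset with the max property and let L := J_color(P). Suppose L is M-structured for M = [[2,−1],[−2,2]]. Write (a,b) := wt(max). Let W be the subgroup of GL₂(ℤ) generated by S_α := [[−1,0],[1,1]] and S_β := [[1,2],[0,−1]] (a finite group of order 8). Then in the group ring ℤ[ℤ²]: (Σ_{s∈L} e^{wt(s)}) · (Σ_{w∈W} det(w) e^{w·(1,1)}) = Σ_{w∈W} det(w) e^{w·(a+1,b+1)}. -/

import Mathlib

open scoped Classical

structure GridData (P : Type) [PartialOrder P] where
  m : ℕ
  chain : P → ℕ
  color : P → Fin 2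

def IsIdeal {P : Type} [PartialOrder P] (t : Finset P) : Prop :=
  ∀ ⦃x⦄, x ∈ t → ∀ ⦃y⦄, y ≤ x → y ∈ t

namespace GridData

variable {P : Type} [PartialOrder P] [Fintype P]

/-- The defining properties of a grid poset. -/
def IsGridPoset (G : GridData P) : Prop :=
  1 ≤ G.m ∧
  (∀ u : P, G.chain u ∈ Finset.Icc 1 G.m) ∧
  (∀ i ∈ Finset.Icc 1 G.m, ∃ u : P, G.chain u = i) ∧
  (∀ u v : P, G.chain u = G.chain v → u ≤ v ∨ v ≤ u) ∧
  (∀ u v : P, u ⋖ v → G.chain u = G.chain v ∨ G.chain u = G.chain v + 1)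

/-- The defining properties of a two-color grid poset. -/
def IsTwoColorGridPoset (G : GridData P) : Prop :=
  G.IsGridPoset ∧
  (∀ u v : P, G.chain u = G.chain v → G.color u = G.color v) ∧
  (∀ u v : P, Relation.ReflTransGen (fun x y : P => x ⋖ y ∨ y ⋖ x) u v →
    G.chain u = G.chain v + 1 → G.color u ≠ G.color v)

/-- The max property. -/
def MaxProperty (G : GridData P) : Prop :=
  (∀ u : P, IsMax u → G.chain u ≤ 2) ∧
  (∀ u v : P, IsMax u → IsMax v → u ≠ v → G.color u ≠ G.color v)

/-- The fiber `C i` of the chain function. -/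
def fiber (G : GridData P) (i : ℕ) : Finset P :=
  Finset.univ.filter (fun u => G.chain u = i)

/-- One step in a `γ`-component of `J_color(P)`: add or remove a single vertex of
color `γ` while both sets are order ideals. -/
def GStep (G : GridData P) (γ : Fin 2) (s t : Finset P) : Prop :=
  IsIdeal s ∧ IsIdeal t ∧ ∃ u : P, G.color u = γ ∧
    ((u ∉ s ∧ t = insert u s) ∨ (u ∉ t ∧ s = insert u t))

/-- The `γ`-component of `t` in `J_color(P)`. -/
def comp (G : GridData P) (γ : Fin 2) (t : Finset P) : Set (Finset P) :=
  {s | Relation.ReflTransGen (G.GStep γ) t s}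

noncomputable def minCard (G : GridData P) (γ : Fin 2) (t : Finset P) : ℕ :=
  sInf (Finset.card '' G.comp γ t)

noncomputable def maxCard (G : GridData P) (γ : Fin 2) (t : Finset P) : ℕ :=
  sSup (Finset.card '' G.comp γ t)

/-- `m_γ(t) = 2 ρ_γ(t) - l_γ(t)`. -/
noncomputable def mcoord (G : GridData P) (γ : Fin 2) (t : Finset P) : ℤ :=
  2 * ((t.card : ℤ) - (G.minCard γ t : ℤ)) - ((G.maxCard γ t : ℤ) - (G.minCard γ t : ℤ))

/-- The weight of an element of `J_color(P)` (color `0` is α, color `1` is β). -/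
noncomputable def wt (G : GridData P) (t : Finset P) : Fin 2 → ℤ :=
  ![G.mcoord 0 t, G.mcoord 1 t]

/-- `J_color(P)` is `M`-structured. -/
def MStructured (G : GridData P) (M : Matrix (Fin 2) (Fin 2) ℤ) : Prop :=
  ∀ s t : Finset P, IsIdeal s → IsIdeal t → ∀ u : P, u ∉ s → t = insert u s →
    G.wt s + M (G.color u) = G.wt t

end GridData

/-- The set of units of the ring of 2×2 integer matrices whose underlying matrices
are the two given generators. -/
def genSet (A B : Matrix (Fin 2) (Fin 2) ℤ) : Set ((Matrix (Fin 2) (Fin 2) ℤ)ˣ) :=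
  {w | (w : Matrix (Fin 2) (Fin 2) ℤ) = A ∨ (w : Matrix (Fin 2) (Fin 2) ℤ) = B}

namespace GridData

variable {P : Type} [PartialOrder P] [Fintype P]

/-- `s` and `t` have the same vertices of color different from `γ`. -/
def SN (G : GridData P) (γ : Fin 2) (s t : Finset P) : Prop :=
  ∀ u, G.color u ≠ γ → (u ∈ s ↔ u ∈ t)

/-- Number of elements of `t` in the chain `i`. -/
noncomputable def cnt (G : GridData P) (t : Finset P) (i : ℕ) : ℕ :=
  (t.filter (fun u => G.chain u = i)).card

/-- Rank of `u` in its chain, starting from one. -/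
noncomputable def rk (G : GridData P) (u : P) : ℕ :=
  (Finset.univ.filter (fun v => G.chain v = G.chain u ∧ v ≤ u)).card

/-- Bottom of the component. -/
noncomputable def bot (G : GridData P) (γ : Fin 2) (s : Finset P) : Finset P :=
  Finset.univ.filter (fun u => if G.color u = γ then ∃ v, u ≤ v ∧ G.color v ≠ γ ∧ v ∈ s else u ∈ s)

/-- Top of the component. -/
noncomputable def top (G : GridData P) (γ : Fin 2) (s : Finset P) : Finset P :=
  Finset.univ.filter (fun u => if G.color u = γ then ∀ v, v ≤ u → G.color v ≠ γ → v ∈ s else u ∈ s)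

/-- Reflection in the component, with shift `d`. -/
noncomputable def refl (G : GridData P) (γ : Fin 2) (d : ℕ → ℕ) (s : Finset P) : Finset P :=
  Finset.univ.filter (fun u => if G.color u = γ then
    G.rk u + d (G.chain u) + G.cnt s (G.chain u) ≤
      G.cnt (G.bot γ s) (G.chain u) + G.cnt (G.top γ s) (G.chain u) else u ∈ s)

lemma ideal_induct (motive : Finset P → Prop) {s : Finset P} (h0 : motive s)
    (hs : IsIdeal s) (t : Finset P) (ht : IsIdeal t) (hst : s ⊆ t)
    (step : ∀ t' u, IsIdeal t' → s ⊆ t' → u ∉ t' → u ∈ t → u ∉ s → IsIdeal (insert u t') →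
      motive t' → motive (insert u t')) : motive t := by
  induction t using Finset.strongInduction with
  | H t ih =>
    by_cases hne : (t \ s).Nonempty
    · obtain ⟨u, hu, hum⟩ := Finset.exists_maximal hne
      rw [Finset.mem_sdiff] at hu
      have hid : IsIdeal (t.erase u) := by
        intro x hx y hy
        rw [Finset.mem_erase] at hx ⊢
        refine ⟨?_, ht hx.2 hy⟩
        rintro rfl
        have hxs : x ∉ s := fun h => hu.2 (hs h hy)
        have := hum (Finset.mem_sdiff.2 ⟨hx.2, hxs⟩) hy
        exact hx.1 (le_antisymm this hy)
      have hsub : s ⊆ t.erase u := fun x hx =>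
        Finset.mem_erase.2 ⟨fun h => hu.2 (h ▸ hx), hst hx⟩
      have h1 := ih (t.erase u) (Finset.erase_ssubset hu.1) hid hsub
        (fun t' v a1 a2 a3 a4 => step t' v a1 a2 a3 (Finset.mem_of_mem_erase a4))
      have h2 := step (t.erase u) u hid hsub (Finset.notMem_erase u t) hu.1 hu.2
        (by rw [Finset.insert_erase hu.1]; exact ht) h1
      rwa [Finset.insert_erase hu.1] at h2
    · rw [Finset.not_nonempty_iff_eq_empty, Finset.sdiff_eq_empty_iff_subset] at hne
      rwa [Finset.Subset.antisymm hne hst]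

variable {G : GridData P} {γ : Fin 2}

lemma SN.symm' {s t : Finset P} (h : G.SN γ s t) : G.SN γ t s := fun u hu => (h u hu).symm

lemma bot_congr {s t : Finset P} (h : G.SN γ s t) : G.bot γ s = G.bot γ t := by
  ext u
  simp only [bot, Finset.mem_filter, Finset.mem_univ, true_and]
  split_ifs with hc
  · constructor
    · rintro ⟨v, h1, h2, h3⟩; exact ⟨v, h1, h2, (h v h2).1 h3⟩
    · rintro ⟨v, h1, h2, h3⟩; exact ⟨v, h1, h2, (h v h2).2 h3⟩
  · exact h u hc

lemma top_congr {s t : Finset P} (h : G.SN γ s t) : G.top γ s = G.top γ t := by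
  ext u
  simp only [top, Finset.mem_filter, Finset.mem_univ, true_and]
  split_ifs with hc
  · constructor
    · intro h1 v h2 h3; exact (h v h3).1 (h1 v h2 h3)
    · intro h1 v h2 h3; exact (h v h3).2 (h1 v h2 h3)
  · exact h u hc

lemma SN_bot (s : Finset P) : G.SN γ s (G.bot γ s) := by
  intro u hu; simp [bot, hu]

lemma SN_top (s : Finset P) : G.SN γ s (G.top γ s) := by
  intro u hu; simp [top, hu]

lemma SN_refl (d : ℕ → ℕ) (s : Finset P) : G.SN γ s (G.refl γ d s) := by
  intro u hu; simp [refl, hu]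

lemma bot_sub {s : Finset P} (hs : IsIdeal s) : G.bot γ s ⊆ s := by
  intro u
  simp only [bot, Finset.mem_filter, Finset.mem_univ, true_and]
  split_ifs with hc
  · rintro ⟨v, h1, h2, h3⟩; exact hs h3 h1
  · exact id

lemma sub_top {s : Finset P} (hs : IsIdeal s) : s ⊆ G.top γ s := by
  intro u hu
  simp only [top, Finset.mem_filter, Finset.mem_univ, true_and]
  split_ifs with hc
  · intro v h1 h2; exact hs hu h1
  · exact hu

lemma bot_ideal {s : Finset P} (hs : IsIdeal s) : IsIdeal (G.bot γ s) := by
  intro u hu v hv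
  have hvs := hs (bot_sub hs hu) hv
  simp only [bot, Finset.mem_filter, Finset.mem_univ, true_and] at hu ⊢
  split_ifs at hu ⊢ with h1 h2 h2
  · obtain ⟨w, a, b⟩ := hu; exact ⟨w, hv.trans a, b⟩
  · exact ⟨u, hv, h2, hu⟩
  · exact hvs
  · exact hvs

lemma top_ideal {s : Finset P} (hs : IsIdeal s) : IsIdeal (G.top γ s) := by
  intro u hu v hv
  simp only [top, Finset.mem_filter, Finset.mem_univ, true_and] at hu ⊢
  split_ifs at hu ⊢ with h1 h2 h2
  · intro w a; exact hu w (a.trans hv)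
  · intro w a b; exact hs hu (a.trans hv)
  · exact hu v hv h1
  · exact hs hu hv

lemma comp_up {s t : Finset P} (hs : IsIdeal s) (ht : IsIdeal t) (h : s ⊆ t)
    (hsn : G.SN γ s t) : Relation.ReflTransGen (G.GStep γ) s t := by
  refine ideal_induct (fun t => Relation.ReflTransGen (G.GStep γ) s t) .refl hs t ht h ?_
  intro t' u h1 h2 h3 h4 h5 h6 h7
  refine h7.tail ⟨h1, h6, u, ?_, Or.inl ⟨h3, rfl⟩⟩
  by_contra hc
  exact h5 ((hsn u hc).2 h4)

lemma gstep_symm {s t : Finset P} (h : G.GStep γ s t) : G.GStep γ t s := by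
  obtain ⟨h1, h2, u, hu, h⟩ := h
  exact ⟨h2, h1, u, hu, h.symm⟩

lemma comp_down {s t : Finset P} (hs : IsIdeal s) (ht : IsIdeal t) (h : s ⊆ t)
    (hsn : G.SN γ s t) : Relation.ReflTransGen (G.GStep γ) t s :=
  by
  have h' := comp_up hs ht h hsn
  clear hsn h ht
  induction h' with
  | refl => exact .refl
  | tail _ h ih => exact ih.head (gstep_symm h)

lemma comp_sn {s t : Finset P} (hs : IsIdeal s) (h : Relation.ReflTransGen (G.GStep γ) s t) :
    IsIdeal t ∧ G.SN γ s t := by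
  induction h with
  | refl => exact ⟨hs, fun u _ => Iff.rfl⟩
  | tail _ h ih =>
    obtain ⟨h1, h2, u, hu, h⟩ := h
    refine ⟨h2, fun v hv => (ih.2 v hv).trans ?_⟩
    have : v ≠ u := by rintro rfl; exact hv hu
    rcases h with ⟨_, rfl⟩ | ⟨_, rfl⟩ <;> simp [this]

lemma mcoord_eq {s : Finset P} (hs : IsIdeal s) :
    G.mcoord γ s = 2 * (s.card : ℤ) - (G.bot γ s).card - (G.top γ s).card := by
  have h1 : G.minCard γ s = (G.bot γ s).card := by
    refine IsLeast.csInf_eq ⟨⟨_, comp_down (bot_ideal hs) hs (bot_sub hs) (SN_bot s).symm', rfl⟩, ?_⟩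
    rintro _ ⟨t, ht, rfl⟩
    obtain ⟨a, b⟩ := comp_sn hs ht
    rw [bot_congr b]; exact Finset.card_le_card (bot_sub a)
  have h2 : G.maxCard γ s = (G.top γ s).card := by
    refine IsGreatest.csSup_eq ⟨⟨_, comp_up hs (top_ideal hs) (sub_top hs) (SN_top s), rfl⟩, ?_⟩
    rintro _ ⟨t, ht, rfl⟩
    obtain ⟨a, b⟩ := comp_sn hs ht
    rw [top_congr b]; exact Finset.card_le_card (sub_top a)
  rw [mcoord, h1, h2]; ring

lemma wt_up {M : Matrix (Fin 2) (Fin 2) ℤ} (hM : G.MStructured M) {s t : Finset P}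
    (hs : IsIdeal s) (ht : IsIdeal t) (h : s ⊆ t) (hsn : G.SN γ s t) :
    G.wt t = G.wt s + ((t.card : ℤ) - s.card) • M γ := by
  refine ideal_induct (fun t => G.wt t = G.wt s + ((t.card : ℤ) - s.card) • M γ) (by simp) hs t ht h ?_
  intro t' u h1 h2 h3 h4 h5 h6 h7
  have hc : G.color u = γ := by
    by_contra hc
    exact h5 ((hsn u hc).2 h4)
  rw [← hM t' _ h1 h6 u h3 rfl, h7, Finset.card_insert_of_notMem h3, hc, add_assoc]
  congr 1
  ext i
  simp
  ring

lemma wt_sn {M : Matrix (Fin 2) (Fin 2) ℤ} (hM : G.MStructured M) {s t : Finset P}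
    (hs : IsIdeal s) (ht : IsIdeal t) (hsn : G.SN γ s t) :
    G.wt t = G.wt s + ((t.card : ℤ) - s.card) • M γ := by
  have h1 := wt_up hM hs (top_ideal hs) (sub_top hs) (SN_top (γ := γ) s)
  have h2 := wt_up hM ht (top_ideal ht) (sub_top ht) (SN_top (γ := γ) t)
  rw [← top_congr hsn, h1] at h2
  ext i
  have := congrFun h2 i
  simp at this ⊢
  linarith

/-! ### Chain structure -/

lemma chain_lemma (hG : G.IsTwoColorGridPoset) {v u : P} (h : v ≤ u) :
    G.chain u ≤ G.chain v ∧ (G.chain v = G.chain u ∨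
      ∃ w, v ≤ w ∧ w ≤ u ∧ G.color w ≠ G.color v ∧ G.chain v = G.chain w + 1) := by
  obtain ⟨⟨-, -, -, -, hcov⟩, hcol, hdiff⟩ := hG
  have h' : Relation.ReflTransGen (· ⋖ ·) v u := by
    let _ : LocallyFiniteOrder P := Fintype.toLocallyFiniteOrder
    exact le_iff_reflTransGen_covBy.1 h
  clear h
  induction h' using Relation.ReflTransGen.head_induction_on with
  | refl => exact ⟨le_rfl, Or.inl rfl⟩
  | @head a c hac hcu ih =>
    have hle : c ≤ u := by
      let _ : LocallyFiniteOrder P := Fintype.toLocallyFiniteOrder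
      exact le_iff_reflTransGen_covBy.2 hcu
    rcases hcov a c hac with h1 | h1
    · refine ⟨by omega, ?_⟩
      rcases ih.2 with h2 | ⟨w, w1, w2, w3, w4⟩
      · left; omega
      · right
        exact ⟨w, hac.le.trans w1, w2, by rw [hcol a c h1]; exact w3, by omega⟩
    · refine ⟨by omega, Or.inr ⟨c, hac.le, hle, ?_, h1⟩⟩
      exact (hdiff a c (.single (Or.inl hac)) h1).symm

/-- Down-closed in each chain. -/
def DC (G : GridData P) (t : Finset P) : Prop :=
  ∀ u ∈ t, ∀ v, v ≤ u → G.chain v = G.chain u → v ∈ t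

lemma dc_of_ideal {t : Finset P} (h : IsIdeal t) : G.DC t := fun _ hu _ hv _ => h hu hv

lemma mem_iff_rk (hG : G.IsTwoColorGridPoset) {t : Finset P} (ht : G.DC t) (u : P) :
    u ∈ t ↔ G.rk u ≤ G.cnt t (G.chain u) := by
  constructor
  · intro h
    refine Finset.card_le_card ?_
    intro v hv
    simp only [Finset.mem_filter, Finset.mem_univ, true_and] at hv ⊢
    exact ⟨ht u h v hv.2 hv.1, hv.1⟩
  · intro h
    by_contra hu
    refine absurd h (not_le.2 (Finset.card_lt_card ?_))
    rw [Finset.ssubset_iff_of_subset]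
    · exact ⟨u, by simp, by simp [hu]⟩
    · intro v hv
      simp only [Finset.mem_filter, Finset.mem_univ, true_and] at hv ⊢
      refine ⟨hv.2, (hG.1.2.2.2.1 v u hv.2).resolve_right fun h1 => hu (ht v hv.1 u h1 hv.2.symm)⟩

lemma cnt_mono {s t : Finset P} (h : s ⊆ t) (i : ℕ) : G.cnt s i ≤ G.cnt t i :=
  Finset.card_le_card (Finset.filter_subset_filter _ h)

lemma cnt_rk (hG : G.IsTwoColorGridPoset) (i n : ℕ) (hn : n ≤ G.cnt Finset.univ i) :
    (Finset.univ.filter (fun u => G.chain u = i ∧ G.rk u ≤ n)).card = n := by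
  have hinj : Set.InjOn G.rk {u | G.chain u = i} := by
    have key : ∀ u v : P, G.chain u = i → G.chain v = i → u ≤ v → G.rk u = G.rk v → u = v := by
      intro u v hu hv huv h
      by_contra hne
      refine absurd h (ne_of_lt (Finset.card_lt_card ?_))
      rw [Finset.ssubset_iff_of_subset]
      · refine ⟨v, by simp, ?_⟩
        simp only [Finset.mem_filter, not_and]
        intro _ _ h3
        exact hne (le_antisymm huv h3)
      · intro w hw
        simp only [Finset.mem_filter, Finset.mem_univ, true_and] at hw ⊢
        exact ⟨by omega, hw.2.trans huv⟩
    intro u hu v hv h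
    rcases hG.1.2.2.2.1 u v (hu.trans hv.symm) with h1 | h1
    · exact key u v hu hv h1 h
    · exact (key v u hv hu h1 h.symm).symm
  have himg : (Finset.univ.filter (fun u => G.chain u = i)).image G.rk =
      Finset.Icc 1 (G.cnt Finset.univ i) := by
    refine Finset.eq_of_subset_of_card_le ?_ ?_
    · intro k hk
      simp only [Finset.mem_image, Finset.mem_filter, Finset.mem_univ, true_and] at hk
      obtain ⟨u, hu, rfl⟩ := hk
      rw [Finset.mem_Icc]
      refine ⟨Finset.card_pos.2 ⟨u, by simp⟩, Finset.card_le_card ?_⟩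
      intro v hv
      simp only [Finset.mem_filter, Finset.mem_univ, true_and] at hv ⊢
      omega
    · rw [Finset.card_image_of_injOn, Nat.card_Icc]
      · rfl
      · intro u hu v hv; exact hinj (by simpa using hu) (by simpa using hv)
  have h2 : (Finset.univ.filter (fun u => G.chain u = i ∧ G.rk u ≤ n)).image G.rk =
      Finset.Icc 1 n := by
    ext k
    have := Finset.ext_iff.1 himg k
    simp only [Finset.mem_image, Finset.mem_filter, Finset.mem_univ, true_and,
      Finset.mem_Icc] at this ⊢
    constructor
    · rintro ⟨u, ⟨h1, h2⟩, rfl⟩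
      exact ⟨(this.1 ⟨u, h1, rfl⟩).1, h2⟩
    · rintro ⟨h1, h2⟩
      obtain ⟨u, h3, rfl⟩ := this.2 ⟨h1, h2.trans hn⟩
      exact ⟨u, ⟨h3, h2⟩, rfl⟩
  have h3 := congrArg Finset.card h2
  rw [Finset.card_image_of_injOn, Nat.card_Icc] at h3
  · simpa using h3
  · intro u hu v hv
    simp only [Finset.coe_filter, Finset.mem_univ, true_and, Set.mem_ofPred_eq] at hu hv
    exact hinj hu.1 hv.1

lemma cnt_sn (hG : G.IsTwoColorGridPoset) {s t : Finset P} (h : G.SN γ s t) {u : P}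
    (hu : G.color u ≠ γ) : G.cnt s (G.chain u) = G.cnt t (G.chain u) := by
  unfold cnt
  congr 1
  ext v
  simp only [Finset.mem_filter, and_congr_left_iff]
  intro hv
  exact h v (by rwa [hG.2.1 v u hv])

lemma cnt_refl (hG : G.IsTwoColorGridPoset) {s : Finset P} (hs : IsIdeal s) {d : ℕ → ℕ}
    (hd : ∀ i, G.cnt s i + d i ≤ G.cnt (G.top γ s) i) (i : ℕ) :
    G.cnt (G.refl γ d s) i + d i + G.cnt s i = G.cnt (G.bot γ s) i + G.cnt (G.top γ s) i := by
  have hb := cnt_mono (G := G) (bot_sub (G := G) (γ := γ) hs) i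
  have hdi := hd i
  have htu := cnt_mono (G := G) (Finset.subset_univ (G.top γ s)) i
  by_cases hi : ∃ u, G.chain u = i
  · obtain ⟨u, rfl⟩ := hi
    by_cases hc : G.color u = γ
    · have := cnt_rk hG (G.chain u) (G.cnt (G.bot γ s) (G.chain u) + G.cnt (G.top γ s) (G.chain u)
        - d (G.chain u) - G.cnt s (G.chain u)) (by omega)
      have h2 : G.cnt (G.refl γ d s) (G.chain u) = G.cnt (G.bot γ s) (G.chain u)
        + G.cnt (G.top γ s) (G.chain u) - d (G.chain u) - G.cnt s (G.chain u) := by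
        rw [← this, cnt]
        congr 1
        ext v
        simp only [Finset.mem_filter, Finset.mem_univ, true_and, refl]
        constructor
        · rintro ⟨h1, h2⟩
          rw [if_pos (by rw [hG.2.1 v u h2, hc]), h2] at h1
          exact ⟨h2, by omega⟩
        · rintro ⟨h2, h1⟩
          refine ⟨?_, h2⟩
          rw [if_pos (by rw [hG.2.1 v u h2, hc]), h2]
          omega
      omega
    · have h1 := cnt_sn hG (SN_bot (γ := γ) s) hc
      have h2 := cnt_sn hG (SN_top (γ := γ) s) hc
      have h3 := cnt_sn hG (SN_refl (γ := γ) d s) hc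
      omega
  · have h0 : ∀ t, G.cnt t i = 0 := by
      intro t
      rw [cnt, Finset.card_eq_zero, Finset.filter_eq_empty_iff]
      exact fun u _ h => hi ⟨u, h⟩
    simp only [h0] at hdi ⊢
    omega

lemma refl_ideal (hG : G.IsTwoColorGridPoset) {s : Finset P} (hs : IsIdeal s) {d : ℕ → ℕ}
    (hd : ∀ i, G.cnt s i + d i ≤ G.cnt (G.top γ s) i) : IsIdeal (G.refl γ d s) := by
  have hbot : G.bot γ s ⊆ G.refl γ d s := by
    intro u hu
    by_cases hc : G.color u = γ
    · have h1 := (mem_iff_rk hG (dc_of_ideal (bot_ideal hs)) u).1 hu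
      simp only [refl, Finset.mem_filter, Finset.mem_univ, true_and, if_pos hc]
      have := hd (G.chain u)
      omega
    · exact (SN_refl d s u hc).1 ((SN_bot s u hc).2 hu)
  have htop : G.refl γ d s ⊆ G.top γ s := by
    intro u hu
    by_cases hc : G.color u = γ
    · rw [mem_iff_rk hG (dc_of_ideal (top_ideal hs)) u]
      simp only [refl, Finset.mem_filter, Finset.mem_univ, true_and, if_pos hc] at hu
      have := cnt_mono (G := G) (bot_sub (G := G) (γ := γ) hs) (G.chain u)
      omega
    · exact (SN_top s u hc).1 ((SN_refl d s u hc).2 hu)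
  intro u hu v hv
  have hvt := top_ideal hs (htop hu) hv
  by_cases hcv : G.color v = γ
  · by_cases hcu : G.color u = γ
    · rcases (chain_lemma hG hv).2 with h | ⟨w, w1, w2, w3, -⟩
      · simp only [refl, Finset.mem_filter, Finset.mem_univ, true_and, if_pos hcu, if_pos hcv] at hu ⊢
        have : G.rk v ≤ G.rk u := by
          refine Finset.card_le_card ?_
          intro w hw
          simp only [Finset.mem_filter, Finset.mem_univ, true_and] at hw ⊢
          exact ⟨by omega, hw.2.trans hv⟩
        rw [h]
        omega
      · refine hbot ?_
        rw [hcv] at w3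
        have hw : w ∈ s := (SN_top s w w3).2 (top_ideal hs (htop hu) w2)
        simp only [bot, Finset.mem_filter, Finset.mem_univ, true_and, if_pos hcv]
        exact ⟨w, w1, w3, hw⟩
    · refine hbot ?_
      simp only [bot, Finset.mem_filter, Finset.mem_univ, true_and, if_pos hcv]
      exact ⟨u, hv, hcu, (SN_refl d s u hcu).2 hu⟩
  · exact (SN_refl d s v hcv).1 ((SN_top s v hcv).2 hvt)

lemma refl_refl (hG : G.IsTwoColorGridPoset) {s : Finset P} (hs : IsIdeal s) {d : ℕ → ℕ}
    (hd : ∀ i, G.cnt s i + d i ≤ G.cnt (G.top γ s) i) :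
    G.refl γ d (G.refl γ d s) = s := by
  ext u
  by_cases hc : G.color u = γ
  · rw [mem_iff_rk hG (dc_of_ideal hs) u, refl]
    have := cnt_refl hG hs hd (G.chain u)
    simp only [Finset.mem_filter, Finset.mem_univ, true_and, if_pos hc,
      ← bot_congr (SN_refl (γ := γ) d s), ← top_congr (SN_refl (γ := γ) d s)]
    omega
  · rw [← SN_refl d _ u hc, ← SN_refl d s u hc]

lemma refl_hd (hG : G.IsTwoColorGridPoset) {s : Finset P} (hs : IsIdeal s) {d : ℕ → ℕ}
    (hd : ∀ i, G.cnt s i + d i ≤ G.cnt (G.top γ s) i) (i : ℕ) :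
    G.cnt (G.refl γ d s) i + d i ≤ G.cnt (G.top γ (G.refl γ d s)) i := by
  rw [← top_congr (SN_refl (γ := γ) d s)]
  have h1 := cnt_refl hG hs hd i
  have := cnt_mono (G := G) (bot_sub (G := G) (γ := γ) hs) i
  omega

lemma card_eq_cnt (hG : G.IsTwoColorGridPoset) (s : Finset P) :
    s.card = ∑ i ∈ Finset.Icc 1 G.m, G.cnt s i :=
  Finset.card_eq_sum_card_fiberwise (fun u _ => hG.1.2.1 u)

lemma refl_card (hG : G.IsTwoColorGridPoset) {s : Finset P} (hs : IsIdeal s) {d : ℕ → ℕ}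
    (hd : ∀ i, G.cnt s i + d i ≤ G.cnt (G.top γ s) i) :
    (G.refl γ d s).card + (∑ i ∈ Finset.Icc 1 G.m, d i) + s.card =
      (G.bot γ s).card + (G.top γ s).card := by
  simp only [card_eq_cnt hG, ← Finset.sum_add_distrib]
  exact Finset.sum_congr rfl fun i _ => cnt_refl hG hs hd i

lemma wt_apply (s : Finset P) (γ : Fin 2) : G.wt s γ = G.mcoord γ s := by
  fin_cases γ <;> rfl

lemma refl_wt (hG : G.IsTwoColorGridPoset) {M : Matrix (Fin 2) (Fin 2) ℤ} (hM : G.MStructured M)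
    {s : Finset P} (hs : IsIdeal s) {d : ℕ → ℕ}
    (hd : ∀ i, G.cnt s i + d i ≤ G.cnt (G.top γ s) i) :
    G.wt (G.refl γ d s) = G.wt s - (G.wt s γ + ∑ i ∈ Finset.Icc 1 G.m, (d i : ℤ)) • M γ := by
  have h1 := wt_sn hM hs (refl_ideal hG hs hd) (SN_refl d s)
  have := refl_card hG hs hd
  zify at this
  have h2 : ((G.refl γ d s).card : ℤ) - s.card =
      -(G.wt s γ + ∑ i ∈ Finset.Icc 1 G.m, (d i : ℤ)) := by
    rw [wt_apply, mcoord_eq hs]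
    linarith
  rw [h1, h2]
  ext i
  simp only [Pi.add_apply, Pi.sub_apply, Pi.smul_apply, smul_eq_mul]
  ring

/-- The matrix of the simple reflection of color `γ`. -/
def refM (γ : Fin 2) : Matrix (Fin 2) (Fin 2) ℤ :=
  if γ = 0 then !![-1, 0; 1, 1] else !![1, 2; 0, -1]

lemma refM_mulVec (γ : Fin 2) (μ : Fin 2 → ℤ) :
    (refM γ).mulVec μ = μ - μ γ • (!![2, -1; -2, 2] : Matrix (Fin 2) (Fin 2) ℤ) γ := by
  fin_cases γ <;> ext i <;> fin_cases i <;>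
    simp [refM, Matrix.mulVec, dotProduct, Fin.sum_univ_two] <;> ring

/-- Invariance of the character under simple reflections. -/
lemma char_refl (hG : G.IsTwoColorGridPoset) (hM : G.MStructured !![2, -1; -2, 2]) (γ : Fin 2) :
    (∑ t ∈ Finset.univ.filter (fun t : Finset P => IsIdeal t),
        AddMonoidAlgebra.single ((refM γ).mulVec (G.wt t)) (1 : ℤ)) =
    (∑ t ∈ Finset.univ.filter (fun t : Finset P => IsIdeal t),
        AddMonoidAlgebra.single (G.wt t) (1 : ℤ)) := by
  have hd : ∀ s : Finset P, IsIdeal s → ∀ i, G.cnt s i + (fun _ : ℕ => 0) i ≤ G.cnt (G.top γ s) i :=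
    fun s hs i => cnt_mono (sub_top hs) i
  refine Finset.sum_bij' (fun s _ => G.refl γ (fun _ => 0) s) (fun s _ => G.refl γ (fun _ => 0) s)
    ?_ ?_ ?_ ?_ ?_
  · intro s hs
    simp only [Finset.mem_filter, Finset.mem_univ, true_and] at hs ⊢
    exact refl_ideal hG hs (hd s hs)
  · intro s hs
    simp only [Finset.mem_filter, Finset.mem_univ, true_and] at hs ⊢
    exact refl_ideal hG hs (hd s hs)
  · intro s hs
    simp only [Finset.mem_filter, Finset.mem_univ, true_and] at hs ⊢
    exact refl_refl hG hs (hd s hs)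
  · intro s hs
    simp only [Finset.mem_filter, Finset.mem_univ, true_and] at hs ⊢
    exact refl_refl hG hs (hd s hs)
  · intro s hs
    simp only [Finset.mem_filter, Finset.mem_univ, true_and] at hs
    rw [refl_wt hG hM hs (hd s hs), refM_mulVec]
    simp

/-- The set of ideals whose last non-full chain is `j`. -/
def Last (G : GridData P) (j : ℕ) (s : Finset P) : Prop :=
  IsIdeal s ∧ (∃ u, u ∉ s ∧ G.chain u = j) ∧ ∀ u, j < G.chain u → u ∈ s

lemma last_hd (hG : G.IsTwoColorGridPoset) {s : Finset P} {u₀ : P}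
    (hs : G.Last (G.chain u₀) s) (i : ℕ) :
    G.cnt s i + (if i = G.chain u₀ then 1 else 0) ≤ G.cnt (G.top (G.color u₀) s) i := by
  obtain ⟨hid, ⟨u, hu, hju⟩, hfull⟩ := hs
  split_ifs with h
  · subst h
    refine Finset.card_lt_card ?_
    rw [Finset.ssubset_iff_of_subset (Finset.filter_subset_filter _ (sub_top hid))]
    have hcu := hG.2.1 u u₀ hju
    refine ⟨u, ?_, by simp [hu]⟩
    simp only [top, Finset.mem_filter, Finset.mem_univ, true_and, if_pos hcu]
    refine ⟨fun v hv hc => hfull v ?_, hju⟩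
    have h1 := (chain_lemma hG hv).1
    have h2 : G.chain v ≠ G.chain u₀ := fun h => hc (hG.2.1 v u₀ h)
    omega
  · exact cnt_mono (sub_top hid) i

lemma last_refl (hG : G.IsTwoColorGridPoset) (hmax : G.MaxProperty) {s : Finset P} {u₀ : P}
    (hs : G.Last (G.chain u₀) s) :
    G.Last (G.chain u₀) (G.refl (G.color u₀) (fun i => if i = G.chain u₀ then 1 else 0) s) := by
  have hd := last_hd hG hs
  have hid := hs.1
  have hfull := hs.2.2
  have hri := refl_ideal (d := fun i => if i = G.chain u₀ then 1 else 0) hG hid hd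
  refine ⟨hri, ?_, ?_⟩
  · by_contra hcon
    push Not at hcon
    have h1 := refl_hd (d := fun i => if i = G.chain u₀ then 1 else 0) hG hid hd (G.chain u₀)
    have h2 := cnt_mono (G := G) (Finset.subset_univ (G.top (G.color u₀)
      (G.refl (G.color u₀) (fun i => if i = G.chain u₀ then 1 else 0) s))) (G.chain u₀)
    have h3 : G.cnt (G.refl (G.color u₀) (fun i => if i = G.chain u₀ then 1 else 0) s) (G.chain u₀)
        = G.cnt Finset.univ (G.chain u₀) := by
      unfold cnt
      congr 1
      ext v
      simp only [Finset.mem_filter, Finset.mem_univ, true_and, and_iff_right_iff_imp]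
      intro hv
      by_contra h
      exact hcon v h hv
    simp only [if_true] at h1
    omega
  · intro u hu
    have hus := hfull u hu
    by_cases hc : G.color u = G.color u₀
    · -- `u` lies in the bottom of the component
      have hub : u ∈ G.bot (G.color u₀) s := by
        simp only [bot, Finset.mem_filter, Finset.mem_univ, true_and, if_pos hc]
        obtain ⟨M, hM1, hM2⟩ := Finite.exists_le_maximal (p := fun _ : P => True) (a := u) trivial
        have hMm : IsMax M := fun y hy => hM2.2 trivial hy
        rcases (chain_lemma hG hM1).2 with h | ⟨w, w1, w2, w3, w4⟩
        · exfalso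
          have h1 := hmax.1 M hMm
          have h2 := Finset.mem_Icc.1 (hG.1.2.1 u₀)
          obtain ⟨N, hN1, hN2⟩ := Finite.exists_le_maximal (p := fun _ : P => True) (a := u₀) trivial
          have hNm : IsMax N := fun y hy => hN2.2 trivial hy
          have h3 := (chain_lemma hG hN1).1
          have h4 := Finset.mem_Icc.1 (hG.1.2.1 N)
          refine hmax.2 M N hMm hNm ?_ ?_
          · rintro rfl; omega
          · rw [hG.2.1 M u h.symm, hc, hG.2.1 N u₀ (by omega)]
        · rw [hc] at w3
          refine ⟨w, w1, w3, hfull w ?_⟩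
          have : G.chain w ≠ G.chain u₀ := fun h => w3 (hG.2.1 w u₀ h)
          omega
      have hb := (SN_refl (G := G) (γ := G.color u₀) (fun i => if i = G.chain u₀ then 1 else 0) s)
      have := bot_sub (G := G) (γ := G.color u₀) hri
      rw [← bot_congr hb] at this
      exact this hub
    · exact (SN_refl _ s u hc).1 hus

/-- Cancellation over ideals whose last non-full chain is the chain of `u₀`. -/
lemma last_sum (hG : G.IsTwoColorGridPoset) (hmax : G.MaxProperty)
    (hM : G.MStructured !![2, -1; -2, 2]) {R : Type*} [AddCommGroup R]
    (hR : ∀ x : R, x + x = 0 → x = 0) (A : (Fin 2 → ℤ) → R)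
    (hA : ∀ γ μ, A ((refM γ).mulVec μ) = - A μ) (u₀ : P) :
    ∑ s ∈ Finset.univ.filter (fun s => G.Last (G.chain u₀) s), A (G.wt s + ![1, 1]) = 0 := by
  have key : ∀ s, G.Last (G.chain u₀) s →
      A (G.wt (G.refl (G.color u₀) (fun i => if i = G.chain u₀ then 1 else 0) s) + ![1, 1]) =
      - A (G.wt s + ![1, 1]) := by
    intro s hs
    rw [← hA (G.color u₀), refM_mulVec,
      refl_wt (d := fun i => if i = G.chain u₀ then 1 else 0) hG hM hs.1 (last_hd hG hs)]
    congr 1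
    have h1 : ∑ i ∈ Finset.Icc 1 G.m, (((if i = G.chain u₀ then 1 else 0 : ℕ)) : ℤ) = 1 := by
      simp only [Nat.cast_ite, Nat.cast_one, Nat.cast_zero]
      rw [Finset.sum_ite_eq', if_pos (hG.1.2.1 u₀)]
    have h2 : (![1, 1] : Fin 2 → ℤ) (G.color u₀) = 1 := by
      generalize G.color u₀ = γ
      fin_cases γ <;> rfl
    rw [h1, Pi.add_apply, h2]
    abel
  refine Finset.sum_involution
    (fun s _ => G.refl (G.color u₀) (fun i => if i = G.chain u₀ then 1 else 0) s) ?_ ?_ ?_ ?_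
  · intro s hs
    simp only [Finset.mem_filter, Finset.mem_univ, true_and] at hs
    rw [key s hs]; simp
  · intro s hs hne heq
    simp only [Finset.mem_filter, Finset.mem_univ, true_and] at hs
    have := key s hs
    rw [heq] at this
    exact hne (hR _ (by nth_rewrite 1 [this]; simp))
  · intro s hs
    simp only [Finset.mem_filter, Finset.mem_univ, true_and] at hs ⊢
    exact last_refl hG hmax hs
  · intro s hs
    simp only [Finset.mem_filter, Finset.mem_univ, true_and] at hs
    exact refl_refl hG hs.1 (last_hd hG hs)

lemma total_sum (hG : G.IsTwoColorGridPoset) (hmax : G.MaxProperty)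
    (hM : G.MStructured !![2, -1; -2, 2]) {R : Type*} [AddCommGroup R]
    (hR : ∀ x : R, x + x = 0 → x = 0) (A : (Fin 2 → ℤ) → R)
    (hA : ∀ γ μ, A ((refM γ).mulVec μ) = - A μ) :
    ∑ s ∈ Finset.univ.filter (fun s : Finset P => IsIdeal s), A (G.wt s + ![1, 1]) =
      A (G.wt Finset.univ + ![1, 1]) := by
  have huniv : (Finset.univ : Finset P) ∈ Finset.univ.filter (fun s : Finset P => IsIdeal s) := by
    exact Finset.mem_filter.2 ⟨Finset.mem_univ _, fun _ _ _ _ => Finset.mem_univ _⟩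
  rw [← Finset.add_sum_erase _ _ huniv, add_eq_left]
  rw [← Finset.sum_fiberwise_of_maps_to (t := Finset.univ.image G.chain)
    (g := fun s : Finset P => (Finset.univ \ s).sup G.chain)]
  · refine Finset.sum_eq_zero fun j hj => ?_
    obtain ⟨u₀, -, rfl⟩ := Finset.mem_image.1 hj
    rw [← last_sum hG hmax hM hR A hA u₀]
    refine Finset.sum_congr ?_ fun _ _ => rfl
    ext s
    simp only [Finset.mem_filter, Finset.mem_erase, Finset.mem_univ, true_and]
    constructor
    · rintro ⟨⟨h1, h2⟩, h3⟩
      refine ⟨h2, ?_, ?_⟩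
      · have hne : (Finset.univ \ s).Nonempty := by
          rw [Finset.nonempty_iff_ne_empty]
          intro h
          exact h1 (Finset.univ_subset_iff.1 (Finset.sdiff_eq_empty_iff_subset.1 h))
        obtain ⟨u, hu, hu'⟩ := Finset.exists_mem_eq_sup _ hne G.chain
        exact ⟨u, by simpa using hu, by rw [← hu', h3]⟩
      · intro u hu
        by_contra hus
        have := Finset.le_sup (f := G.chain) (show u ∈ Finset.univ \ s by simpa using hus)
        omega
    · rintro ⟨h1, ⟨u, hu, hu'⟩, h3⟩
      refine ⟨⟨?_, h1⟩, ?_⟩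
      · rintro rfl; simp at hu
      · refine le_antisymm (Finset.sup_le fun v hv => ?_) ?_
        · by_contra h
          exact (Finset.mem_sdiff.1 hv).2 (h3 v (by omega))
        · rw [← hu']
          exact Finset.le_sup (f := G.chain) (show u ∈ Finset.univ \ s by simpa using hu)
  · intro s hs
    have hne : (Finset.univ \ s).Nonempty := by
      rw [Finset.nonempty_iff_ne_empty]
      intro h
      exact (Finset.mem_erase.1 hs).1
        (Finset.univ_subset_iff.1 (Finset.sdiff_eq_empty_iff_subset.1 h))
    obtain ⟨u, hu, hu'⟩ := Finset.exists_mem_eq_sup _ hne G.chain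
    exact Finset.mem_image.2 ⟨u, Finset.mem_univ _, hu'.symm⟩

end GridData

/-! ### The group -/

/-- The eight matrices of the group. -/
def eightM : List (Matrix (Fin 2) (Fin 2) ℤ) :=
  [!![1, 0; 0, 1], !![-1, 0; 1, 1], !![1, 2; 0, -1], !![-1, -2; 1, 1], !![1, 2; -1, -1],
   !![-1, -2; 0, 1], !![1, 0; -1, -1], !![-1, 0; 0, -1]]

lemma closure_eight (w : (Matrix (Fin 2) (Fin 2) ℤ)ˣ)
    (hw : w ∈ Subgroup.closure (genSet !![-1, 0; 1, 1] !![1, 2; 0, -1])) :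
    (w : Matrix (Fin 2) (Fin 2) ℤ) ∈ eightM := by
  have hmul : ∀ x ∈ eightM, ∀ y ∈ eightM, x * y ∈ eightM := by decide
  have hinv : ∀ x ∈ eightM, ∃ y ∈ eightM, x * y = 1 := by decide
  induction hw using Subgroup.closure_induction with
  | mem x hx => rcases hx with h | h <;> rw [h] <;> decide
  | one => decide
  | mul x y _ _ hx hy => exact hmul _ hx _ hy
  | inv x _ hx =>
    obtain ⟨y, hy, hxy⟩ := hinv _ hx
    have : ((x⁻¹ : (Matrix (Fin 2) (Fin 2) ℤ)ˣ) : Matrix (Fin 2) (Fin 2) ℤ) = y := by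
      rw [← mul_one ((x⁻¹ : (Matrix (Fin 2) (Fin 2) ℤ)ˣ) : Matrix (Fin 2) (Fin 2) ℤ), ← hxy,
        ← mul_assoc, Units.inv_mul, one_mul]
    rwa [this]

lemma refM_unit (γ : Fin 2) : ∃ w ∈ genSet !![-1, 0; 1, 1] !![1, 2; 0, -1],
    (w : Matrix (Fin 2) (Fin 2) ℤ) = GridData.refM γ := by
  have h : GridData.refM γ * GridData.refM γ = 1 := by revert γ; decide
  refine ⟨⟨_, _, h, h⟩, ?_, rfl⟩
  show GridData.refM γ = _ ∨ GridData.refM γ = _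
  unfold GridData.refM
  split_ifs <;> simp

lemma refM_det (γ : Fin 2) : (GridData.refM γ).det = -1 := by
  fin_cases γ <;> simp [GridData.refM, Matrix.det_fin_two]

theorem stmt_2 {P : Type} [PartialOrder P] [Fintype P] (G : GridData P)
    (hG : G.IsTwoColorGridPoset) (hmax : G.MaxProperty)
    (hM : G.MStructured !![2, -1; -2, 2])
    (a b : ℤ) (ha : a = G.wt Finset.univ 0) (hb : b = G.wt Finset.univ 1)
    (W : Subgroup ((Matrix (Fin 2) (Fin 2) ℤ)ˣ))
    (hW : W = Subgroup.closure (genSet !![-1, 0; 1, 1] !![1, 2; 0, -1])) :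
    (∑ t ∈ Finset.univ.filter (fun t : Finset P => IsIdeal t),
        AddMonoidAlgebra.single (G.wt t) (1 : ℤ)) *
      (∑ᶠ w ∈ (W : Set ((Matrix (Fin 2) (Fin 2) ℤ)ˣ)), AddMonoidAlgebra.single
          ((w : Matrix (Fin 2) (Fin 2) ℤ).mulVec ![1, 1])
          ((w : Matrix (Fin 2) (Fin 2) ℤ).det)) =
    ∑ᶠ w ∈ (W : Set ((Matrix (Fin 2) (Fin 2) ℤ)ˣ)), AddMonoidAlgebra.single
        ((w : Matrix (Fin 2) (Fin 2) ℤ).mulVec ![a + 1, b + 1])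
        ((w : Matrix (Fin 2) (Fin 2) ℤ).det) := by
  
  classical
  have hfin : (W : Set ((Matrix (Fin 2) (Fin 2) ℤ)ˣ)).Finite := by
    have h1 : {x : Matrix (Fin 2) (Fin 2) ℤ | x ∈ eightM}.Finite := List.finite_toSet eightM
    refine (h1.preimage (f := fun w : (Matrix (Fin 2) (Fin 2) ℤ)ˣ => (w : Matrix (Fin 2) (Fin 2) ℤ))
      (Units.val_injective.injOn)).subset ?_
    intro w hw
    rw [hW] at hw
    exact closure_eight w hw
  set WF := hfin.toFinset with hWF
  have hmem : ∀ w, w ∈ WF ↔ w ∈ W := by intro w; simp [hWF]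
  have hsum : ∀ f : (Matrix (Fin 2) (Fin 2) ℤ)ˣ → AddMonoidAlgebra ℤ (Fin 2 → ℤ),
      ∑ᶠ w ∈ (W : Set ((Matrix (Fin 2) (Fin 2) ℤ)ˣ)), f w = ∑ w ∈ WF, f w :=
    fun f => finsum_mem_eq_finite_toFinset_sum f hfin
  rw [hsum, hsum]
  -- invariance of the character
  have hinv : ∀ w ∈ W, (∑ t ∈ Finset.univ.filter (fun t : Finset P => IsIdeal t),
        AddMonoidAlgebra.single ((w : Matrix (Fin 2) (Fin 2) ℤ).mulVec (G.wt t)) (1 : ℤ)) =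
      ∑ t ∈ Finset.univ.filter (fun t : Finset P => IsIdeal t),
        AddMonoidAlgebra.single (G.wt t) (1 : ℤ) := by
    have hmap : ∀ (x : Matrix (Fin 2) (Fin 2) ℤ) (f : Finset P → (Fin 2 → ℤ)),
        AddMonoidAlgebra.mapDomain (fun μ => x.mulVec μ)
          (∑ t ∈ Finset.univ.filter (fun t : Finset P => IsIdeal t),
            AddMonoidAlgebra.single (f t) (1 : ℤ)) =
        ∑ t ∈ Finset.univ.filter (fun t : Finset P => IsIdeal t),
            AddMonoidAlgebra.single (x.mulVec (f t)) (1 : ℤ) := by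
      intro x f
      generalize Finset.univ.filter (fun t : Finset P => IsIdeal t) = S
      induction S using Finset.induction_on with
      | empty => rw [Finset.sum_empty, Finset.sum_empty, AddMonoidAlgebra.mapDomain_zero]
      | insert t S ht ih =>
        rw [Finset.sum_insert ht, Finset.sum_insert ht, AddMonoidAlgebra.mapDomain_add, ih,
          AddMonoidAlgebra.mapDomain_single]
    intro w hw
    rw [hW] at hw
    induction hw using Subgroup.closure_induction with
    | mem x hx =>
      have : ∃ γ, (x : Matrix (Fin 2) (Fin 2) ℤ) = GridData.refM γ := by
        rcases hx with h | h
        · exact ⟨0, h⟩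
        · exact ⟨1, h⟩
      obtain ⟨γ, h⟩ := this
      rw [h]
      exact GridData.char_refl hG hM γ
    | one => simp
    | mul x y _ _ hx hy =>
      have := hmap x (fun t => (y : Matrix (Fin 2) (Fin 2) ℤ).mulVec (G.wt t))
      rw [hy, hmap, hx] at this
      rw [this]
      simp only [Matrix.mulVec_mulVec, Units.val_mul]
    | inv x _ hx =>
      have := hmap ((x⁻¹ : (Matrix (Fin 2) (Fin 2) ℤ)ˣ) : Matrix (Fin 2) (Fin 2) ℤ)
        (fun t => (x : Matrix (Fin 2) (Fin 2) ℤ).mulVec (G.wt t))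
      rw [hx, hmap] at this
      rw [this]
      simp only [Matrix.mulVec_mulVec, Units.inv_mul, Matrix.one_mulVec]
  set A : (Fin 2 → ℤ) → AddMonoidAlgebra ℤ (Fin 2 → ℤ) := fun μ =>
    ∑ w ∈ WF, AddMonoidAlgebra.single ((w : Matrix (Fin 2) (Fin 2) ℤ).mulVec μ)
      ((w : Matrix (Fin 2) (Fin 2) ℤ).det) with hAdef
  have hA : ∀ γ μ, A ((GridData.refM γ).mulVec μ) = - A μ := by
    intro γ μ
    obtain ⟨g, hg, hgγ⟩ := refM_unit γ
    have hgW : g ∈ W := by rw [hW]; exact Subgroup.subset_closure hg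
    simp only [hAdef]
    rw [← Finset.sum_neg_distrib]
    refine Finset.sum_bij' (fun w _ => w * g) (fun w _ => w * g⁻¹) ?_ ?_ ?_ ?_ ?_
    · intro w hw; rw [hmem] at hw ⊢; exact W.mul_mem hw hgW
    · intro w hw; rw [hmem] at hw ⊢; exact W.mul_mem hw (W.inv_mem hgW)
    · intro w _; simp
    · intro w _; simp
    · intro w _
      rw [Units.val_mul, hgγ, Matrix.det_mul, refM_det, Matrix.mulVec_mulVec, mul_neg_one,
        AddMonoidAlgebra.single_neg, neg_neg]
  have hR : ∀ x : AddMonoidAlgebra ℤ (Fin 2 → ℤ), x + x = 0 → x = 0 := by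
    intro x hx
    ext μ
    have := congrArg (fun y : AddMonoidAlgebra ℤ (Fin 2 → ℤ) => y.coeff μ) hx
    simp at this
    simpa using this
  have htot := GridData.total_sum hG hmax hM hR A hA
  have hab : G.wt Finset.univ + ![1, 1] = ![a + 1, b + 1] := by
    ext i
    fin_cases i
    · simp [ha]
    · simp [hb]
  rw [hab] at htot
  rw [show (∑ w ∈ WF, AddMonoidAlgebra.single
      ((w : Matrix (Fin 2) (Fin 2) ℤ).mulVec ![a + 1, b + 1])
      ((w : Matrix (Fin 2) (Fin 2) ℤ).det)) = A ![a + 1, b + 1] from rfl, ← htot]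
  simp only [hAdef]
  rw [Finset.sum_comm, Finset.mul_sum]
  refine Finset.sum_congr rfl fun w hw => ?_
  rw [← hinv w ((hmem w).1 hw), Finset.sum_mul]
  refine Finset.sum_congr rfl fun t _ => ?_
  rw [AddMonoidAlgebra.single_mul_single, one_mul, Matrix.mulVec_add]
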